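/- Let d ≥ 2 and let P be a d-dimensional pattern of side length k over {0,1} with k ≥ 3·2^d. Let A be a binary d-dimensional array containing a copy of P starting at position p (the template), and suppose that for every x ∈ [k]^d, the array obtained from A by flipping the entry at p+x contains a copy of P at some position where A contains no copy of P. Then for every i ∈ {1,…,d} there exists an integer Δ_i with 0 < Δ_i < k/3 such that the number of pairs (x,y) of points of [k]^d that are (i,Δ_i)-related and satisfy P_x ≠ P_y is at most 2. -/

import Mathlib

/-- `A`, a `d`-dimensional array of side length `n`, contains a copy of the
`d`-dimensional pattern `P` of side length `k` starting at `x`. -/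
def HasCopy {Γ : Type*} (d n k : ℕ) (A P : (Fin d → ℕ) → Γ) (x : Fin d → ℕ) : Prop :=
  (∀ i, x i + k ≤ n) ∧ ∀ y : Fin d → ℕ, (∀ i, y i < k) → A (fun i => x i + y i) = P y

/-- The pair of points `(x, y)` is `(i, δ)`-related: `y i - x i = δ` and `y j = x j`
for every `j ≠ i`. -/
def Related (d : ℕ) (i : Fin d) (δ : ℕ) (x y : Fin d → ℕ) : Prop :=
  y i = x i + δ ∧ ∀ j, j ≠ i → y j = x j

/-- `A` agrees with the translate of `P` to `q` except at the single position `w`. -/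
def IsNearCopy {Γ : Type*} (d k : ℕ) (A P : (Fin d → ℕ) → Γ) (q w : Fin d → ℕ) : Prop :=
  (∀ i, w i < k) ∧ A (fun i => q i + w i) ≠ P w ∧
    ∀ y : Fin d → ℕ, (∀ i, y i < k) → y ≠ w → A (fun i => q i + y i) = P y

lemma IsNearCopy.unique {Γ : Type*} {d k : ℕ} {A P : (Fin d → ℕ) → Γ} {q v w : Fin d → ℕ}
    (hv : IsNearCopy d k A P q v) (hw : IsNearCopy d k A P q w) : v = w := by
  by_contra h
  exact hv.2.1 (hw.2.2 v hv.1 h)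

/-- If flipping the entry `z` creates a copy at `q`, then `A` is a near copy at `q` whose
mismatch is at `z`. -/
lemma exists_isNearCopy_of_flip {d n k : ℕ} {A P : (Fin d → ℕ) → Bool} {q z : Fin d → ℕ}
    (h : HasCopy d n k (Function.update A z (!(A z))) P q) (hA : ¬ HasCopy d n k A P q) :
    ∃ w, IsNearCopy d k A P q w ∧ z = fun i => q i + w i := by
  have hz : ∃ w : Fin d → ℕ, (∀ i, w i < k) ∧ z = fun i => q i + w i := by
    by_contra! hne
    refine hA ⟨h.1, fun y hy => ?_⟩
    rw [← h.2 y hy, Function.update_of_ne (hne y hy).symm]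
  obtain ⟨w, hw, hzw⟩ := hz
  refine ⟨w, ⟨hw, ?_, fun y hy hyw => ?_⟩, hzw⟩
  · rw [← h.2 w hw, ← hzw]
    simp
  · rw [← h.2 y hy, Function.update_of_ne]
    intro heq
    apply hyw
    funext i
    have := congrFun (heq.trans hzw) i
    simpa using this

/-- Two near copies whose positions differ by `δ` in direction `i` leave at most two
`(i, δ)`-jumps in the pattern. -/
lemma ncard_jumps_le_two {Γ : Type*} {d k : ℕ} {A P : (Fin d → ℕ) → Γ}
    {q q' w w' : Fin d → ℕ} {i : Fin d} {δ : ℕ}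
    (hw : IsNearCopy d k A P q w) (hw' : IsNearCopy d k A P q' w') (hq : Related d i δ q q') :
    Set.ncard {pr : (Fin d → ℕ) × (Fin d → ℕ) |
        (∀ j, pr.1 j < k) ∧ (∀ j, pr.2 j < k) ∧
        Related d i δ pr.1 pr.2 ∧ P pr.1 ≠ P pr.2} ≤ 2 := by
  refine (Set.ncard_le_ncard (t := {(Function.update w i (w i - δ), w),
    (w', Function.update w' i (w' i + δ))}) ?_ (Set.toFinite _)).trans ((Set.ncard_insert_le _ _).trans (by simp))
  rintro ⟨a, b⟩ ⟨ha, hb, ⟨hab, hab'⟩, hP⟩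
  dsimp only at ha hb hab hab' hP
  have hmem : b = w ∨ a = w' := by
    by_contra! hne
    apply hP
    rw [← hw.2.2 b hb hne.1, ← hw'.2.2 a ha hne.2]
    congr 1
    funext j
    by_cases hj : j = i
    · subst hj
      rw [hab, hq.1]
      ring
    · rw [hab' j hj, hq.2 j hj]
  rcases hmem with rfl | rfl
  · left
    refine Prod.ext (funext fun j => ?_) rfl
    by_cases hj : j = i
    · subst hj
      simp [hab]
    · simp [hj, hab' j hj]
  · right
    refine Prod.ext rfl (funext fun j => ?_)
    by_cases hj : j = i
    · subst hj
      simp [hab]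
    · simp [hj, hab' j hj]

/-- Among `k ^ d` distinct positions at distance less than `k` from `p`, two lie on a common
line in direction `i` at distance less than `k / 3`. -/
lemma exists_close_positions {d k : ℕ} (hd : 2 ≤ d) (hk : 3 * 2 ^ d ≤ k) (i : Fin d) (p : Fin d → ℕ)
    (q : (Fin d → Fin k) → Fin d → ℕ) (hq : Function.Injective q)
    (hqp : ∀ x j, p j < q x j + k ∧ q x j < p j + k) :
    ∃ x y δ, 0 < δ ∧ 3 * δ < k ∧ Related d i δ (q x) (q y) := by
  have hk0 : 0 < k := lt_of_lt_of_le (by positivity) hk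
  let u : (Fin d → Fin k) → Fin d → ℕ := fun x j => q x j + (k - 1) - p j
  have hu : ∀ x j, u x j + p j = q x j + (k - 1) ∧ u x j < 2 * k - 1 := by
    intro x j
    have := hqp x j
    simp only [u]
    omega
  let f : (Fin d → Fin k) → Fin d → ℕ :=
    fun x j => if j = i then 3 * u x j / k else u x j
  let T : Finset (Fin d → ℕ) :=
    Fintype.piFinset fun j => if j = i then Finset.range 6 else Finset.range (2 * k - 1)
  have hcard : T.card < (Finset.univ : Finset (Fin d → Fin k)).card := by
    have hT : T.card = 6 * (2 * k - 1) ^ (d - 1) := by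
      rw [Fintype.card_piFinset, ← Finset.mul_prod_erase _ _ (Finset.mem_univ i)]
      rw [Finset.prod_congr rfl (g := fun _ => 2 * k - 1)
        (fun j hj => by simp [Finset.ne_of_mem_erase hj])]
      simp
    rw [hT, Finset.card_univ, Fintype.card_fun, Fintype.card_fin, Fintype.card_fin]
    obtain ⟨e, rfl⟩ : ∃ e, d = e + 1 := ⟨d - 1, by omega⟩
    rw [Nat.add_sub_cancel]
    calc 6 * (2 * k - 1) ^ e < 6 * (2 * k) ^ e := by
          gcongr
          · omega
          · omega
      _ = (3 * 2 ^ (e + 1)) * k ^ e := by rw [mul_pow]; ring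
      _ ≤ k * k ^ e := by gcongr
      _ = k ^ (e + 1) := by ring
  obtain ⟨x, -, y, -, hxy, hf⟩ := Finset.exists_ne_map_eq_of_card_lt_of_maps_to (f := f) hcard (by
    intro x _
    simp only [T, Finset.mem_coe, Fintype.mem_piFinset]
    intro j
    have := hu x j
    by_cases hj : j = i
    · simp only [f, hj, if_true, Finset.mem_range]
      rw [Nat.div_lt_iff_lt_mul hk0]
      have := hu x i
      omega
    · simpa [f, hj] using this.2)
  have hline : ∀ j, j ≠ i → q x j = q y j := by
    intro j hj
    have h := congrFun hf j
    simp only [f, hj, if_false] at h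
    have := hu x j
    have := hu y j
    omega
  have hi : 3 * q x i < 3 * q y i + k ∧ 3 * q y i < 3 * q x i + k := by
    have h := congrFun hf i
    simp only [f, if_true] at h
    have h1 := Nat.div_add_mod (3 * u x i) k
    have h2 := Nat.div_add_mod (3 * u y i) k
    have h3 := Nat.mod_lt (3 * u x i) hk0
    have h4 := Nat.mod_lt (3 * u y i) hk0
    rw [h] at h1
    have := hu x i
    have := hu y i
    omega
  have hne : q x i ≠ q y i := by
    intro h
    refine hxy (hq (funext fun j => ?_))
    by_cases hj : j = i
    · rw [hj, h]
    · exact hline j hj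
  rcases lt_or_gt_of_ne hne with h | h
  · exact ⟨x, y, q y i - q x i, by omega, by omega, by omega, fun j hj => (hline j hj).symm⟩
  · exact ⟨y, x, q x i - q y i, by omega, by omega, by omega, hline⟩

/-- If every flip of an entry of the template copy of `P` in `A` creates a new copy
of `P`, then for every direction `i` there is `0 < Δᵢ < k/3` such that at most two
`(i, Δᵢ)`-related pairs of points of `[k]^d` are `(i, Δᵢ)`-jumps in `P`. -/
theorem stmt6 (d n k : ℕ) (hd : 2 ≤ d) (hk : 3 * 2 ^ d ≤ k)
    (P A : (Fin d → ℕ) → Bool) (p : Fin d → ℕ)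
    (hcopy : HasCopy d n k A P p)
    (hflip : ∀ x : Fin d → ℕ, (∀ i, x i < k) →
      ∃ q : Fin d → ℕ,
        HasCopy d n k
          (Function.update A (fun i => p i + x i) (!(A (fun i => p i + x i)))) P q ∧
        ¬ HasCopy d n k A P q) :
    ∀ i : Fin d, ∃ Δ : ℕ, 0 < Δ ∧ 3 * Δ < k ∧
      Set.ncard {pr : (Fin d → ℕ) × (Fin d → ℕ) |
        (∀ j, pr.1 j < k) ∧ (∀ j, pr.2 j < k) ∧
        Related d i Δ pr.1 pr.2 ∧ P pr.1 ≠ P pr.2} ≤ 2 := by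
  intro i
  have hnear : ∀ x : Fin d → Fin k, ∃ q w : Fin d → ℕ, IsNearCopy d k A P q w ∧
      (fun j => p j + (x j : ℕ)) = fun j => q j + w j := by
    intro x
    obtain ⟨q, hq, hq'⟩ := hflip (fun j => x j) (fun j => (x j).isLt)
    exact ⟨q, exists_isNearCopy_of_flip hq hq'⟩
  choose q w hqw hpq using hnear
  have hinj : Function.Injective q := by
    intro x y h
    have hw : w x = w y := by
      have hx := hqw x
      rw [h] at hx
      exact hx.unique (hqw y)
    have hxy := hpq x
    rw [h, hw, ← hpq y] at hxy
    funext j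
    have := congrFun hxy j
    exact Fin.ext (by simpa using this)
  have hbound : ∀ x j, p j < q x j + k ∧ q x j < p j + k := by
    intro x j
    have h1 := congrFun (hpq x) j
    have h2 := (hqw x).1 j
    have h3 := (x j).isLt
    omega
  obtain ⟨x, y, δ, hδ, hδk, hrel⟩ := exists_close_positions hd hk i p q hinj hbound
  exact ⟨δ, hδ, hδk, ncard_jumps_le_two (hqw x) (hqw y) hrel⟩
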